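/- arXiv:2110.04058 — 2 statements merged into one kernel-verified Lean document; each statement's English description precedes it below -/
import Mathlib

section
/- Let G = Θ(l_1,l_2,l_3) be a Theta graph with l_1 = min_{i∈[3]} l_i ≥ 1 and l_i ≥ 2 for i ∈ {2,3}. If the parity of l_1 is different from the parities of both l_2 and l_3, then P_DP(G,m) = P(G,m) for all m ∈ ℕ. -/
open Finset

/-- An `m`-fold cover `𝓗 = (L, H)` of `G`, represented (up to isomorphism) on the vertex set
`V × Fin m`, with `L v = {v} × Fin m`.  The fields record that each part `L v` induces a
clique in `H`, that cross-edges occur only over edges of `G`, and that the cross-edges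
between two parts form a (possibly empty) matching. -/
structure DPCover {V : Type*} (G : SimpleGraph V) (m : ℕ) where
  H : SimpleGraph (V × Fin m)
  fiber_clique : ∀ (v : V) (a b : Fin m), a ≠ b → H.Adj (v, a) (v, b)
  cross_only_edges : ∀ (u v : V) (a b : Fin m), u ≠ v → H.Adj (u, a) (v, b) → G.Adj u v
  cross_matching : ∀ (u v : V), u ≠ v → ∀ (a b b' : Fin m),
    H.Adj (u, a) (v, b) → H.Adj (u, a) (v, b') → b = b'

/-- A full `m`-fold cover: every matching between `L u` and `L v` for `uv ∈ E(G)` is perfect. -/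
def DPCover.IsFull {V : Type*} {G : SimpleGraph V} {m : ℕ} (C : DPCover G m) : Prop :=
  ∀ (u v : V), G.Adj u v → ∀ a : Fin m, ∃ b : Fin m, C.H.Adj (u, a) (v, b)

/-- `P_DP(G, 𝓗)`: the number of `𝓗`-colorings of `G`, i.e. of independent sets in `H` of size
`|V(G)|` (equivalently, of independent transversals of the parts `L v`). -/
noncomputable def DPCover.count {V : Type*} {G : SimpleGraph V} {m : ℕ} (C : DPCover G m) : ℕ :=
  Nat.card {c : V → Fin m // ∀ u v : V, u ≠ v → ¬ C.H.Adj (u, c u) (v, c v)}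

/-- The DP color function `P_DP(G, m)`: the minimum of `P_DP(G, 𝓗)` over all
`m`-fold covers `𝓗` of `G`. -/
noncomputable def PDP {V : Type*} (G : SimpleGraph V) (m : ℕ) : ℕ :=
  sInf (Set.range fun C : DPCover G m => C.count)

/-- The dual DP color function `P*_DP(G, m)`: the maximum of `P_DP(G, 𝓗)` over all full
`m`-fold covers `𝓗` of `G`. -/
noncomputable def PDPdual {V : Type*} (G : SimpleGraph V) (m : ℕ) : ℕ :=
  sSup {k : ℕ | ∃ C : DPCover G m, C.IsFull ∧ C.count = k}

/-- The chromatic polynomial `P(G, m)`: the number of proper colorings of `G` with colors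
from `{1, …, m}`. -/
noncomputable def chromP {V : Type*} (G : SimpleGraph V) (m : ℕ) : ℕ :=
  Nat.card {c : V → Fin m // ∀ u v : V, G.Adj u v → c u ≠ c v}

/-- Vertices of the generalized theta graph `Θ(l 0, …, l (n-1))`: two end vertices
`u = Sum.inl false` and `w = Sum.inl true`, and internal vertices `(i, j)` with
`j ∈ {0, …, l i - 2}` for the `i`-th path (listed along the path from `u` to `w`). -/
abbrev ThetaV {n : ℕ} (l : Fin n → ℕ) : Type :=
  Bool ⊕ (Σ i : Fin n, Fin (l i - 1))

/-- The relation generating the edges of the generalized theta graph. -/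
def thetaRel {n : ℕ} (l : Fin n → ℕ) : ThetaV l → ThetaV l → Prop
  | Sum.inl _, Sum.inl _ => ∃ i, l i = 1
  | Sum.inl a, Sum.inr ⟨i, j⟩ => (a = false ∧ (j : ℕ) = 0) ∨ (a = true ∧ (j : ℕ) = l i - 2)
  | Sum.inr _, Sum.inl _ => False
  | Sum.inr ⟨i, j⟩, Sum.inr ⟨i', j'⟩ => i = i' ∧ (j' : ℕ) = (j : ℕ) + 1

/-- The generalized theta graph `Θ(l 0, …, l (n-1))`: two end vertices `u` and `w` joined by
`n` internally disjoint paths, the `i`-th of length `l i`. -/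
def thetaGraph {n : ℕ} (l : Fin n → ℕ) : SimpleGraph (ThetaV l) :=
  SimpleGraph.fromRel (thetaRel l)

/-- The end vertex `u`. -/
def thetaU {n : ℕ} (l : Fin n → ℕ) : ThetaV l := Sum.inl false

/-- The end vertex `w`. -/
def thetaW {n : ℕ} (l : Fin n → ℕ) : ThetaV l := Sum.inl true

/-- The sequence `a, g 0, …, g (k-1), b` of values read along a path. -/
def pathSeq {α : Type*} {k : ℕ} (a b : α) (g : Fin k → α) : Fin (k + 2) → α :=
  Fin.cons a (Fin.snoc g b)

/-- `f` avoids the permutations `σ`: consecutive values never satisfy `f (j+1) = σ j (f j)`. -/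
def Avoids {α : Type*} {n : ℕ} (σ : Fin n → Equiv.Perm α) (f : Fin (n + 1) → α) : Prop :=
  ∀ j : Fin n, f j.succ ≠ σ j (f j.castSucc)

/-- The number of `m`-colorings of a path with `k` interior vertices whose end vertices have
prescribed, distinct colors. -/
def pathBase (m : ℤ) : ℕ → ℤ
  | 0 => 1
  | k + 1 => (m - 1) * pathBase m k + (-1) ^ (k + 1)

lemma comp_pathSeq {α β : Type*} {k : ℕ} (c : α → β) (a b : α) (g : Fin k → α) (j : Fin (k + 2)) :
    c (pathSeq a b g j) = pathSeq (c a) (c b) (fun i => c (g i)) j := by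
  refine Fin.cases rfl (fun j => ?_) j
  refine Fin.lastCases ?_ (fun j => ?_) j <;> simp [pathSeq]

lemma pathSeq_cons {α : Type*} {k : ℕ} (a b x : α) (g : Fin k → α) :
    pathSeq a b (Fin.cons x g : Fin (k + 1) → α) = Fin.cons a (pathSeq x b g) := by
  simp [pathSeq, Fin.cons_snoc_eq_snoc_cons]

lemma avoids_cons {α : Type*} {n : ℕ} (σ : Fin (n + 1) → Equiv.Perm α) (a : α)
    (f : Fin (n + 1) → α) :
    Avoids σ (Fin.cons a f : Fin (n + 2) → α) ↔ f 0 ≠ σ 0 a ∧ Avoids (fun j => σ j.succ) f := by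
  unfold Avoids
  rw [Fin.forall_fin_succ]
  simp

open Classical in
/-- The number of colorings of the interior of a path avoiding `σ` takes two values, according
to whether the color of the second end is the image of that of the first. -/
lemma exists_card_avoids {m : ℕ} (k : ℕ) (σ : Fin (k + 1) → Equiv.Perm (Fin m)) :
    ∃ τ : Equiv.Perm (Fin m), ((∀ j, σ j = 1) → τ = 1) ∧ ∀ a b : Fin m,
      ((#{g : Fin k → Fin m | Avoids σ (pathSeq a b g)} : ℕ) : ℤ) =
        pathBase m k + (-1) ^ (k + 1) * if b = τ a then 1 else 0 := by
  induction k with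
  | zero =>
    refine ⟨σ 0, fun h => h 0, fun a b => ?_⟩
    by_cases h : b = σ 0 a
    all_goals simp [Avoids, pathSeq, pathBase, h, Finset.filter_true_of_mem, Fin.snoc]
  | succ k ih =>
    obtain ⟨τ, hτ, H⟩ := ih (fun j => σ j.succ)
    refine ⟨τ * σ 0, fun h => by rw [hτ (fun j => h _), h]; rfl, fun a b => ?_⟩
    have key : #{g : Fin (k + 1) → Fin m | Avoids σ (pathSeq a b g)} =
        ∑ x : Fin m, if x = σ 0 a then 0 else
          #{g : Fin k → Fin m | Avoids (fun j => σ j.succ) (pathSeq x b g)} := by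
      simp_rw [Finset.card_filter]
      rw [← (Fin.consEquiv (fun _ : Fin (k + 1) => Fin m)).sum_comp, Fintype.sum_prod_type]
      refine Finset.sum_congr rfl fun x _ => ?_
      have hx (x : Fin m) (g : Fin k → Fin m) : pathSeq x b g 0 = x := rfl
      by_cases h : x = σ 0 a <;>
        simp [Fin.consEquiv, pathSeq_cons, avoids_cons, hx, h]
    have h1 : ∀ x : Fin m, (((if x = σ 0 a then 0 else
        #{g : Fin k → Fin m | Avoids (fun j => σ j.succ) (pathSeq x b g)} : ℕ)) : ℤ) =
        (pathBase m k + (-1) ^ (k + 1) * (if τ.symm b = x then 1 else 0)) -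
        (if x = σ 0 a then
          (pathBase m k + (-1) ^ (k + 1) * (if b = τ (σ 0 a) then 1 else 0)) else 0) := by
      intro x
      by_cases h : x = σ 0 a
      · simp [h, Equiv.symm_apply_eq]
      · simp [h, H, Equiv.symm_apply_eq]
    rw [Equiv.Perm.mul_apply, key, Nat.cast_sum, Finset.sum_congr rfl fun x _ => h1 x]
    simp only [Finset.sum_sub_distrib, Finset.sum_add_distrib, ← Finset.mul_sum,
      Finset.sum_ite_eq, Finset.sum_ite_eq', Finset.mem_univ, if_true, Finset.sum_const,
      Finset.card_univ, Fintype.card_fin, pathBase, nsmul_eq_mul]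
    ring

lemma pathBase_nonneg {m : ℤ} (hm : 2 ≤ m) (k : ℕ) :
    0 ≤ pathBase m k ∧ 0 ≤ pathBase m k + (-1) ^ (k + 1) := by
  induction k with
  | zero => simp [pathBase]
  | succ k ih =>
    have h : (-1 : ℤ) ^ (k + 1 + 1) = -(-1) ^ (k + 1) := by ring
    rw [h]
    simp only [pathBase]
    constructor <;> nlinarith

lemma pathBase_add_le {m : ℤ} (hm : 2 ≤ m) (k t : ℕ) :
    pathBase m k + (-1) ^ (k + 1) ≤ pathBase m (k + 1 + 2 * t) := by
  have step (k : ℕ) : pathBase m k + (-1) ^ (k + 1) ≤ pathBase m (k + 1) := by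
    simp only [pathBase]
    nlinarith [pathBase_nonneg hm k]
  induction t with
  | zero => exact step k
  | succ t ih =>
    have h := step (k + 1 + 2 * t + 1)
    have h2 : pathBase m (k + 1 + 2 * t + 1) + (-1) ^ (k + 1 + 2 * t + 1 + 1) =
      (m - 1) * pathBase m (k + 1 + 2 * t) := by simp only [pathBase]; ring
    have h3 := (pathBase_nonneg hm (k + 1 + 2 * t)).1
    have h4 : k + 1 + 2 * (t + 1) = k + 1 + 2 * t + 1 + 1 := by ring
    rw [h4]
    nlinarith

lemma sum_prod_add_indicator {m : ℕ} (x y z : Fin m) (p q r e f g : ℤ) :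
    ∑ b : Fin m, (p + e * if b = x then 1 else 0) * (q + f * if b = y then 1 else 0) *
        (r + g * if b = z then 1 else 0) =
      m * (p * q * r) + e * q * r + p * f * r + p * q * g +
        e * f * r * (if x = y then 1 else 0) + e * g * q * (if x = z then 1 else 0) +
        f * g * p * (if y = z then 1 else 0) +
        e * f * g * (if x = y ∧ x = z then 1 else 0) := by
  have h : ∀ b : Fin m, (p + e * if b = x then 1 else 0) * (q + f * if b = y then 1 else 0) *
        (r + g * if b = z then 1 else 0) = p * q * r + (if b = x then e * q * r else 0) +
        (if b = y then p * f * r else 0) + (if b = z then p * q * g else 0) +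
        (if b = x then e * f * r * (if x = y then 1 else 0) else 0) +
        (if b = x then e * g * q * (if x = z then 1 else 0) else 0) +
        (if b = y then f * g * p * (if y = z then 1 else 0) else 0) +
        (if b = x then e * f * g * (if x = y ∧ x = z then 1 else 0) else 0) := by
    intro b
    by_cases hx : b = x <;> by_cases hy : b = y <;> by_cases hz : b = z
    all_goals try subst hx
    all_goals try subst hy
    all_goals try subst hz
    all_goals simp_all
    all_goals ring
  rw [Finset.sum_congr rfl fun b _ => h b]
  simp [Finset.sum_add_distrib]

/-- The number of colorings extending a fixed color at one end is smallest when the three paths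
transport that color to the same color at the other end. -/
lemma sum_prod_path_le {m k₀ k₁ k₂ : ℕ} (a x y z : Fin m) (h₁ : k₀ ≤ k₁) (h₂ : k₀ ≤ k₂)
    (hp₁ : k₀ % 2 ≠ k₁ % 2) (hp₂ : k₀ % 2 ≠ k₂ % 2) :
    ∑ b : Fin m, (pathBase m k₀ + (-1) ^ (k₀ + 1) * if b = a then 1 else 0) *
        (pathBase m k₁ + (-1) ^ (k₁ + 1) * if b = a then 1 else 0) *
        (pathBase m k₂ + (-1) ^ (k₂ + 1) * if b = a then 1 else 0) ≤
      ∑ b : Fin m, (pathBase m k₀ + (-1) ^ (k₀ + 1) * if b = x then 1 else 0) *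
        (pathBase m k₁ + (-1) ^ (k₁ + 1) * if b = y then 1 else 0) *
        (pathBase m k₂ + (-1) ^ (k₂ + 1) * if b = z then 1 else 0) := by
  rw [sum_prod_add_indicator, sum_prod_add_indicator]
  by_cases hall : x = y ∧ x = z
  · obtain ⟨rfl, rfl⟩ := hall
    simp
  have hm : (2 : ℤ) ≤ m := by
    have : 1 < m := by
      by_contra hm
      have : Subsingleton (Fin m) := Fin.subsingleton_iff_le_one.2 (by omega)
      exact hall ⟨Subsingleton.elim _ _, Subsingleton.elim _ _⟩
    exact_mod_cast this
  obtain ⟨s, rfl⟩ : ∃ s, k₁ = k₀ + 1 + 2 * s := ⟨(k₁ - k₀ - 1) / 2, by omega⟩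
  obtain ⟨t, rfl⟩ : ∃ t, k₂ = k₀ + 1 + 2 * t := ⟨(k₂ - k₀ - 1) / 2, by omega⟩
  have hs := pathBase_add_le hm k₀ s
  have ht := pathBase_add_le hm k₀ t
  obtain ⟨hP, hP'⟩ := pathBase_nonneg hm k₀
  have e (s : ℕ) : (-1 : ℤ) ^ (k₀ + 1 + 2 * s + 1) = -(-1) ^ (k₀ + 1) := by
    rw [show k₀ + 1 + 2 * s + 1 = (k₀ + 1) + 2 * s + 1 by ring, pow_succ, pow_add, pow_mul]
    simp
  rw [e s, e t]
  generalize pathBase m (k₀ + 1 + 2 * s) = q at *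
  generalize pathBase m (k₀ + 1 + 2 * t) = r at *
  generalize pathBase m k₀ = p at *
  have h := neg_one_pow_eq_or ℤ (k₀ + 1)
  generalize (-1 : ℤ) ^ (k₀ + 1) = ε at *
  rcases h with rfl | rfl <;>
  by_cases hxy : x = y <;> by_cases hxz : x = z <;> by_cases hyz : y = z <;>
  simp_all <;> nlinarith

/-- The vertices of the `i`-th path of the theta graph, from `u` to `w`. -/
def thetaPath {n : ℕ} (l : Fin n → ℕ) (i : Fin n) : Fin (l i - 1 + 2) → ThetaV l :=
  pathSeq (Sum.inl false) (Sum.inl true) fun j => Sum.inr ⟨i, j⟩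

lemma thetaPath_last {n : ℕ} (l : Fin n → ℕ) (i : Fin n) :
    thetaPath l i (Fin.last _) = Sum.inl true := by
  rw [← Fin.succ_last]
  simp [thetaPath, pathSeq]

lemma thetaPath_succ_castSucc {n : ℕ} (l : Fin n → ℕ) (i : Fin n) (j : Fin (l i - 1)) :
    thetaPath l i j.castSucc.succ = Sum.inr ⟨i, j⟩ := by
  simp [thetaPath, pathSeq]

lemma thetaPath_eq {n : ℕ} (l : Fin n → ℕ) (i : Fin n) (j : Fin (l i - 1 + 2)) :
    thetaPath l i j = if (j : ℕ) = 0 then Sum.inl false else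
      if h : (j : ℕ) - 1 < l i - 1 then Sum.inr ⟨i, ⟨j - 1, h⟩⟩ else Sum.inl true := by
  refine Fin.cases rfl (fun j => ?_) j
  refine Fin.lastCases ?_ (fun j => ?_) j
  · simp [thetaPath_last]
  · simp [thetaPath_succ_castSucc]

lemma thetaPath_castSucc_ne_succ {n : ℕ} (l : Fin n → ℕ) (i : Fin n) (j : Fin (l i - 1 + 1)) :
    thetaPath l i j.castSucc ≠ thetaPath l i j.succ := by
  have hj := j.2
  simp only [thetaPath_eq, Fin.val_castSucc, Fin.val_succ]
  split_ifs <;> simp <;> omega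

lemma thetaRel_thetaPath {n : ℕ} (l : Fin n → ℕ) (i : Fin n) (j : Fin (l i - 1 + 1))
    (hi : 1 ≤ l i) :
    thetaRel l (thetaPath l i j.castSucc) (thetaPath l i j.succ) ∨
      thetaRel l (thetaPath l i j.succ) (thetaPath l i j.castSucc) := by
  have hj := j.2
  simp only [thetaPath_eq, Fin.val_castSucc, Fin.val_succ]
  split_ifs <;> simp [thetaRel] <;>
    first | contradiction | omega | exact ⟨i, by omega⟩ | exact Fin.ext (by assumption)

lemma exists_thetaPath_of_thetaRel {n : ℕ} (l : Fin n → ℕ) {x y : ThetaV l}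
    (hxy : x ≠ y) (h : thetaRel l x y) :
    ∃ i, ∃ j : Fin (l i - 1 + 1),
      (x = thetaPath l i j.castSucc ∧ y = thetaPath l i j.succ) ∨
      (y = thetaPath l i j.castSucc ∧ x = thetaPath l i j.succ) := by
  simp only [thetaPath_eq, Fin.val_castSucc, Fin.val_succ]
  rcases x with a | ⟨i, j⟩ <;> rcases y with b | ⟨i', j'⟩
  · obtain ⟨i, hi⟩ := h
    refine ⟨i, 0, ?_⟩
    cases a <;> cases b <;> simp_all
  · obtain ⟨j', hj⟩ := j'
    rcases h with ⟨rfl, h⟩ | ⟨rfl, h⟩ <;> dsimp only at h <;> subst h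
    · refine ⟨i', 0, Or.inl ?_⟩
      simp [show 1 < l i' by omega]
    · refine ⟨i', Fin.last _, Or.inr ?_⟩
      simp [show l i' - 1 ≠ 0 by omega, Nat.sub_sub]
      omega
  · exact h.elim
  · obtain ⟨rfl, h⟩ := h
    obtain ⟨j', hj⟩ := j'
    dsimp only at h
    subst h
    refine ⟨i, ⟨j + 1, by omega⟩, Or.inl ?_⟩
    simp [hj]

lemma thetaGraph_adj_iff {n : ℕ} (l : Fin n → ℕ) (hl : ∀ i, 1 ≤ l i) (x y : ThetaV l) :
    (thetaGraph l).Adj x y ↔ ∃ i, ∃ j : Fin (l i - 1 + 1),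
      (x = thetaPath l i j.castSucc ∧ y = thetaPath l i j.succ) ∨
      (y = thetaPath l i j.castSucc ∧ x = thetaPath l i j.succ) := by
  rw [thetaGraph, SimpleGraph.fromRel_adj]
  constructor
  · rintro ⟨hne, h | h⟩
    · exact exists_thetaPath_of_thetaRel l hne h
    · obtain ⟨i, j, h⟩ := exists_thetaPath_of_thetaRel l hne.symm h
      exact ⟨i, j, h.symm⟩
  · rintro ⟨i, j, ⟨rfl, rfl⟩ | ⟨rfl, rfl⟩⟩
    · exact ⟨thetaPath_castSucc_ne_succ l i j, thetaRel_thetaPath l i j (hl i)⟩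
    · exact ⟨(thetaPath_castSucc_ne_succ l i j).symm, (thetaRel_thetaPath l i j (hl i)).symm⟩

open Classical in
/-- Colorings of a theta graph avoiding permutations along its paths are counted path by path. -/
lemma card_theta_avoids {n m : ℕ} (l : Fin n → ℕ)
    (σ : ∀ i, Fin (l i - 1 + 1) → Equiv.Perm (Fin m)) :
    Nat.card {c : ThetaV l → Fin m // ∀ i, Avoids (σ i) (fun j => c (thetaPath l i j))} =
      ∑ a : Fin m, ∑ b : Fin m, ∏ i,
        #{g : Fin (l i - 1) → Fin m | Avoids (σ i) (pathSeq a b g)} := by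
  let e : {c : ThetaV l → Fin m // ∀ i, Avoids (σ i) (fun j => c (thetaPath l i j))} ≃
      Σ p : Fin m × Fin m,
        ∀ i, {g : Fin (l i - 1) → Fin m // Avoids (σ i) (pathSeq p.1 p.2 g)} :=
    { toFun := fun c => ⟨(c.1 (Sum.inl false), c.1 (Sum.inl true)), fun i =>
        ⟨fun j => c.1 (Sum.inr ⟨i, j⟩), by
          have h := c.2 i
          simp only [thetaPath, comp_pathSeq] at h
          exact h⟩⟩
      invFun := fun p => ⟨Sum.elim (fun t => if t then p.1.2 else p.1.1)
        (fun s => (p.2 s.1).1 s.2), fun i => by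
          have h := (p.2 i).2
          simp only [thetaPath, comp_pathSeq]
          exact h⟩
      left_inv := by
        rintro ⟨c, hc⟩
        ext x
        rcases x with (_ | _) | x <;> rfl
      right_inv := fun p => rfl }
  rw [Nat.card_congr e, Nat.card_eq_fintype_card, Fintype.card_sigma, Fintype.sum_prod_type]
  simp [Fintype.card_pi, Fintype.card_subtype]

/-- The cover whose matchings are identities; its colorings are the proper colorings. -/
def DPCover.identity {V : Type*} (G : SimpleGraph V) (m : ℕ) : DPCover G m where
  H :=
    { Adj := fun x y => (x.1 = y.1 ∧ x.2 ≠ y.2) ∨ (G.Adj x.1 y.1 ∧ x.2 = y.2)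
      symm := ⟨fun x y h => h.imp (fun h => ⟨h.1.symm, h.2.symm⟩) (fun h => ⟨h.1.symm, h.2.symm⟩)⟩
      loopless := ⟨fun x h => h.elim (fun h => h.2 rfl) (fun h => h.1.ne rfl)⟩ }
  fiber_clique := fun v a b h => Or.inl ⟨rfl, h⟩
  cross_only_edges := fun u v a b h h' => h'.elim (fun h' => (h h'.1).elim) (fun h' => h'.1)
  cross_matching := fun u v h a b b' h₁ h₂ => by
    simp only [h, false_and, false_or] at h₁ h₂
    exact h₁.2.symm.trans h₂.2

lemma DPCover.identity_count {V : Type*} (G : SimpleGraph V) (m : ℕ) :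
    (DPCover.identity G m).count = chromP G m := by
  refine Nat.card_congr (Equiv.subtypeEquivRight fun c => ?_)
  refine forall₂_congr fun u v => ⟨fun h h' hc => h h'.ne (Or.inr ⟨h', hc⟩), ?_⟩
  rintro h hne (⟨h', -⟩ | ⟨h', hc⟩)
  exacts [hne h', h h' hc]

/-- Every matching of a cover extends to a permutation of the colors. -/
lemma DPCover.exists_perm {V : Type*} {G : SimpleGraph V} {m : ℕ} (C : DPCover G m) {u v : V}
    (huv : u ≠ v) : ∃ σ : Equiv.Perm (Fin m), ∀ a b, C.H.Adj (u, a) (v, b) → b = σ a := by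
  classical
  choose f hf using fun x : {a : Fin m // ∃ b, C.H.Adj (u, a) (v, b)} => x.2
  have hinj : Function.Injective f := fun x y h => Subtype.ext <|
    C.cross_matching v u huv.symm (f x) x y (hf x).symm (h ▸ (hf y).symm)
  let e := Equiv.ofInjective f hinj
  refine ⟨Equiv.extendSubtype (q := fun x => x ∈ Set.range f) e, fun a b h => ?_⟩
  rw [Equiv.extendSubtype_apply_of_mem e a ⟨b, h⟩]
  exact C.cross_matching u v huv a b _ h (hf ⟨a, b, h⟩)

/-- Let `G = Θ(l_1,l_2,l_3)` with `l_1 = min l_i ≥ 1` and `l_2, l_3 ≥ 2`.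
If the parity of `l_1` differs from the parities of both `l_2` and `l_3`, then
`P_DP(G,m) = P(G,m)` for all `m ∈ ℕ`. -/
theorem statement5 (l : Fin 3 → ℕ)
    (hmin : ∀ i : Fin 3, l 0 ≤ l i) (hl1 : 1 ≤ l 0) (hl2 : 2 ≤ l 1) (hl3 : 2 ≤ l 2)
    (hpar2 : l 0 % 2 ≠ l 1 % 2) (hpar3 : l 0 % 2 ≠ l 2 % 2) :
    ∀ m : ℕ, 1 ≤ m → PDP (thetaGraph l) m = chromP (thetaGraph l) m := by
  intro m _
  have hl : ∀ i, 1 ≤ l i := fun i => hl1.trans (hmin i)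
  refine le_antisymm (Nat.sInf_le ⟨_, DPCover.identity_count _ m⟩)
    (le_csInf ⟨_, DPCover.identity _ m, rfl⟩ ?_)
  rintro _ ⟨C, rfl⟩
  choose σ hσ using fun i j => C.exists_perm (thetaPath_castSucc_ne_succ l i j)
  have hC : Nat.card {c : ThetaV l → Fin m // ∀ i, Avoids (σ i) (fun j => c (thetaPath l i j))} ≤
      C.count := by
    refine Nat.card_mono (Set.toFinite _) fun c hc u v hne hadj => ?_
    obtain ⟨i, j, ⟨rfl, rfl⟩ | ⟨rfl, rfl⟩⟩ :=
      (thetaGraph_adj_iff l hl u v).1 (C.cross_only_edges _ _ _ _ hne hadj)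
    exacts [hc i j (hσ i j _ _ hadj), hc i j (hσ i j _ _ hadj.symm)]
  have hP : chromP (thetaGraph l) m = Nat.card {c : ThetaV l → Fin m //
      ∀ i, Avoids (fun _ : Fin (l i - 1 + 1) => 1) (fun j => c (thetaPath l i j))} := by
    refine Nat.card_congr (Equiv.subtypeEquivRight fun c => ⟨fun h i j => ?_, fun h u v huv => ?_⟩)
    · exact (h _ _ ((thetaGraph_adj_iff l hl _ _).2 ⟨i, j, Or.inl ⟨rfl, rfl⟩⟩)).symm
    · obtain ⟨i, j, ⟨rfl, rfl⟩ | ⟨rfl, rfl⟩⟩ := (thetaGraph_adj_iff l hl u v).1 huv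
      exacts [(h i j).symm, h i j]
  refine le_trans ?_ hC
  rw [hP, card_theta_avoids, card_theta_avoids]
  choose τ _ hτ using fun i => exists_card_avoids (l i - 1) (σ i)
  choose ρ hρ hρ' using fun i => exists_card_avoids (m := m) (l i - 1) fun _ => 1
  zify
  refine Finset.sum_le_sum fun a _ => ?_
  have hρ1 : ∀ i, ρ i = 1 := fun i => hρ i fun _ => rfl
  simp only [hτ, hρ', hρ1, Fin.prod_univ_three, Equiv.Perm.one_apply]
  have h1 := hmin 1
  have h2 := hmin 2
  exact sum_prod_path_le a _ _ _ (by omega) (by omega) (by omega) (by omega)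
end

section
/- Let G = Θ(l_1,l_2,l_3) be a Theta graph with l_1 = min_{i∈[3]} l_i ≥ 1 and l_i ≥ 2 for i ∈ {2,3}. If the parity of l_1 is the same as that of l_3 and different from that of l_2, then for all m ≥ 2: P_DP(G,m) = (1/m)·[ (m−1)^{l_1+l_2+l_3} + (m−1)^{l_1} − (m−1)^{l_2} − (m−1)^{l_3+1} + (−1)^{l_2+1}(m−2) ]. -/
open Finset

/-- A partial matching between two copies of a finite type extends to a permutation. -/
lemma exists_perm_of_matching {α : Type*} [Finite α] (R : α → α → Prop)
    (hfun : ∀ a b b', R a b → R a b' → b = b') (hinj : ∀ a a' b, R a b → R a' b → a = a') :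
    ∃ σ : Equiv.Perm α, ∀ a b, R a b → b = σ a := by
  classical
  have := Fintype.ofFinite α
  choose f hf using fun a : {a // ∃ b, R a b} => a.2
  choose g hg using fun b : {b // ∃ a, R a b} => b.2
  let e : {a // ∃ b, R a b} ≃ {b // ∃ a, R a b} :=
    { toFun := fun a => ⟨f a, a, hf a⟩
      invFun := fun b => ⟨g b, b, hg b⟩
      left_inv := fun a => Subtype.ext (hinj _ _ _ (hg ⟨f a, a, hf a⟩) (hf a))
      right_inv := fun b => Subtype.ext (hfun _ _ _ (hf ⟨g b, b, hg b⟩) (hg b)) }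
  refine ⟨e.extendSubtype, fun a b hab => ?_⟩
  rw [Equiv.extendSubtype_apply_of_mem e a ⟨b, hab⟩]
  exact hfun _ _ _ hab (hf ⟨a, b, hab⟩)

section Path

variable {m : ℕ}

/-- Colorings of the `n` internal vertices of a path with `n + 1` edges whose ends are colored
`a` and `b`, where the `j`-th edge forbids the pairs `(x, τ j x)`. -/
abbrev PathColoring {n : ℕ} (τ : Fin (n + 1) → Equiv.Perm (Fin m)) (a b : Fin m) : Type :=
  {g : Fin n → Fin m // ∀ j : Fin (n + 1),
    (Fin.snoc g b : Fin (n + 1) → Fin m) j ≠ τ j ((Fin.cons a g : Fin (n + 1) → Fin m) j)}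

/-- The composition of the permutations along a path. -/
def pathPerm : {n : ℕ} → (Fin n → Equiv.Perm (Fin m)) → Equiv.Perm (Fin m)
  | 0, _ => 1
  | _ + 1, τ => pathPerm (fun j => τ j.succ) * τ 0

lemma pathPerm_eq_one {n : ℕ} (τ : Fin n → Equiv.Perm (Fin m)) (h : ∀ j, τ j = 1) :
    pathPerm τ = 1 := by
  induction n with
  | zero => rfl
  | succ n ih => rw [pathPerm, ih _ fun j => h _, h, one_mul]

lemma pathPerm_eq_zero {n : ℕ} (τ : Fin (n + 1) → Equiv.Perm (Fin m))
    (h : ∀ j : Fin n, τ j.succ = 1) : pathPerm τ = τ 0 := by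
  rw [pathPerm, pathPerm_eq_one _ h, one_mul]

/-- The number of walks of length `n` between two given distinct vertices of `K_m`. -/
def walkCount (m n : ℕ) : ℚ := (((m : ℚ) - 1) ^ n - (-1) ^ n) / m

/-- Splitting a path coloring at its first internal vertex. -/
def pathColoringSuccEquiv {n : ℕ} (τ : Fin (n + 2) → Equiv.Perm (Fin m)) (a b : Fin m) :
    PathColoring τ a b ≃
      Σ x : {x : Fin m // x ≠ τ 0 a}, PathColoring (fun j => τ j.succ) x.1 b where
  toFun g := ⟨⟨g.1 0, by simpa [Fin.snoc] using g.2 0⟩, Fin.tail g.1, fun j => by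
    have h := g.2 j.succ
    rw [← Fin.cons_self_tail g.1, ← Fin.cons_snoc_eq_snoc_cons] at h
    simpa only [Fin.cons_succ] using h⟩
  invFun s := ⟨Fin.cons s.1.1 s.2.1, fun j => by
    rw [← Fin.cons_snoc_eq_snoc_cons]
    induction j using Fin.cases with
    | zero => simpa using s.1.2
    | succ j => simpa only [Fin.cons_succ] using s.2.2 j⟩
  left_inv g := Subtype.ext (Fin.cons_self_tail g.1)
  right_inv s := by
    obtain ⟨⟨x, hx⟩, ⟨g, hg⟩⟩ := s
    rfl

lemma card_pathColoring (hm : m ≠ 0) {n : ℕ} (τ : Fin (n + 1) → Equiv.Perm (Fin m))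
    (a b : Fin m) :
    (Nat.card (PathColoring τ a b) : ℚ) =
      walkCount m (n + 1) + (-1) ^ (n + 1) * if pathPerm τ a = b then 1 else 0 := by
  have hm' : (m : ℚ) ≠ 0 := by exact_mod_cast hm
  induction n generalizing a with
  | zero =>
    have h1 : walkCount m 1 = 1 := by
      rw [walkCount]; field_simp; ring
    by_cases h : τ 0 a = b
    · have : IsEmpty (PathColoring τ a b) := ⟨fun g => g.2 0 (by simp [Fin.snoc, h])⟩
      simp [h1, pathPerm, h]
    · have : Unique (PathColoring τ a b) :=
        { default := ⟨Fin.elim0, fun j => by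
            rw [Fin.fin_one_eq_zero j]; simpa [Fin.snoc] using Ne.symm h⟩
          uniq := fun g => Subtype.ext (Subsingleton.elim _ _) }
      simp [h1, pathPerm, h]
  | succ n ih =>
    have hw : walkCount m (n + 2) = (m - 1) * walkCount m (n + 1) + (-1) ^ (n + 1) := by
      simp only [walkCount]; field_simp; ring
    rw [Nat.card_congr (pathColoringSuccEquiv τ a b), Nat.card_sigma, Nat.cast_sum]
    simp_rw [ih]
    rw [← Finset.sum_subtype (univ.erase (τ 0 a)) (by simp) (f := fun x =>
      walkCount m (n + 1) + (-1) ^ (n + 1) *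
        if pathPerm (fun j => τ j.succ) x = b then (1 : ℚ) else 0),
      Finset.sum_erase_eq_sub (mem_univ _), sum_add_distrib, ← mul_sum]
    have hs : ∑ x, (if pathPerm (fun j => τ j.succ) x = b then (1 : ℚ) else 0) = 1 := by
      simp [← Equiv.eq_symm_apply]
    have hp : pathPerm τ a = pathPerm (fun j => τ j.succ) (τ 0 a) := rfl
    rw [hs, hw, hp]
    simp only [sum_const, card_univ, Fintype.card_fin, nsmul_eq_mul]
    ring

end Path

section Theta

variable {n : ℕ} (l : Fin n → ℕ)

/-- The initial vertex of the `j`-th edge of the `i`-th path. -/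
def thetaSrc (i : Fin n) : Fin (l i - 1 + 1) → ThetaV l :=
  Fin.cons (thetaU l) fun j => Sum.inr ⟨i, j⟩

/-- The final vertex of the `j`-th edge of the `i`-th path. -/
def thetaTgt (i : Fin n) : Fin (l i - 1 + 1) → ThetaV l :=
  Fin.snoc (fun j => Sum.inr ⟨i, j⟩) (thetaW l)

variable {l}

lemma thetaSrc_zero (i : Fin n) : thetaSrc l i 0 = thetaU l := rfl

lemma thetaSrc_succ (i : Fin n) (j : Fin (l i - 1)) : thetaSrc l i j.succ = Sum.inr ⟨i, j⟩ := rfl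

lemma thetaTgt_castSucc (i : Fin n) (j : Fin (l i - 1)) :
    thetaTgt l i j.castSucc = Sum.inr ⟨i, j⟩ := by simp [thetaTgt]

lemma thetaTgt_last (i : Fin n) : thetaTgt l i (Fin.last _) = thetaW l := by simp [thetaTgt]

lemma thetaGraph_adj_src_tgt (hl : ∀ i, 1 ≤ l i) (i : Fin n) (j : Fin (l i - 1 + 1)) :
    (thetaGraph l).Adj (thetaSrc l i j) (thetaTgt l i j) := by
  have hi := hl i
  rw [thetaGraph, SimpleGraph.fromRel_adj]
  cases hj : j using Fin.cases with
  | zero =>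
    rw [thetaSrc_zero]
    cases hk : j using Fin.lastCases with
    | last =>
      have h0 : (Fin.last (l i - 1) : Fin (l i - 1 + 1)) = 0 := hk.symm.trans hj
      have h1 := congrArg Fin.val h0
      simp only [Fin.val_last, Fin.val_zero] at h1
      rw [← h0, thetaTgt_last]
      exact ⟨by simp [thetaU, thetaW], Or.inl ⟨i, by omega⟩⟩
    | cast k =>
      have h0 : k.castSucc = 0 := hk.symm.trans hj
      have h1 := congrArg Fin.val h0
      rw [← h0, thetaTgt_castSucc]
      exact ⟨by simp [thetaU], Or.inl (Or.inl ⟨rfl, by simpa using h1⟩)⟩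
  | succ j' =>
    rw [thetaSrc_succ]
    cases hk : j using Fin.lastCases with
    | last =>
      have h0 : (Fin.last (l i - 1) : Fin (l i - 1 + 1)) = j'.succ := hk.symm.trans hj
      have h1 := congrArg Fin.val h0
      simp only [Fin.val_last, Fin.val_succ] at h1
      rw [← h0, thetaTgt_last]
      exact ⟨by simp [thetaW], Or.inr (Or.inr ⟨rfl, by omega⟩)⟩
    | cast k =>
      have h0 : k.castSucc = j'.succ := hk.symm.trans hj
      have h1 := congrArg Fin.val h0
      simp only [Fin.val_castSucc, Fin.val_succ] at h1
      rw [← h0, thetaTgt_castSucc]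
      refine ⟨fun h => ?_, Or.inl ⟨rfl, h1⟩⟩
      have : j' = k := by simpa using h
      subst this
      omega

lemma exists_src_tgt_of_thetaRel {x y : ThetaV l} (hxy : x ≠ y)
    (h : thetaRel l x y) : ∃ i j, (x = thetaSrc l i j ∧ y = thetaTgt l i j) ∨
      (y = thetaSrc l i j ∧ x = thetaTgt l i j) := by
  rcases x with a | ⟨i, j⟩ <;> rcases y with b | ⟨i', j'⟩
  · obtain ⟨i, hi⟩ := h
    refine ⟨i, 0, ?_⟩
    have h0 : (0 : Fin (l i - 1 + 1)) = Fin.last _ := by ext; simp [hi]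
    have ht : thetaTgt l i 0 = thetaW l := by rw [h0, thetaTgt_last]
    rw [thetaSrc_zero, ht]
    cases a <;> cases b <;> simp_all [thetaU, thetaW]
  · rcases h with ⟨rfl, h⟩ | ⟨rfl, h⟩
    · refine ⟨i', j'.castSucc, Or.inl ⟨?_, (thetaTgt_castSucc _ _).symm⟩⟩
      have h0 : j'.castSucc = 0 := by ext; simpa using h
      rw [h0, thetaSrc_zero]; rfl
    · refine ⟨i', j'.succ, Or.inr ⟨(thetaSrc_succ _ _).symm, ?_⟩⟩
      have h0 : j'.succ = Fin.last _ := by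
        ext; have := j'.2; simp only [Fin.val_succ, Fin.val_last]; omega
      rw [h0, thetaTgt_last]; rfl
  · exact h.elim
  · obtain ⟨rfl, h⟩ := h
    refine ⟨i, j.succ, Or.inl ⟨(thetaSrc_succ _ _).symm, ?_⟩⟩
    have h0 : j.succ = j'.castSucc := by ext; simp [h]
    rw [h0, thetaTgt_castSucc]

lemma exists_src_tgt_of_adj {x y : ThetaV l} (h : (thetaGraph l).Adj x y) :
    ∃ i j, (x = thetaSrc l i j ∧ y = thetaTgt l i j) ∨
      (y = thetaSrc l i j ∧ x = thetaTgt l i j) := by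
  rw [thetaGraph, SimpleGraph.fromRel_adj] at h
  obtain ⟨hne, h | h⟩ := h
  · exact exists_src_tgt_of_thetaRel hne h
  · obtain ⟨i, j, h⟩ := exists_src_tgt_of_thetaRel hne.symm h
    exact ⟨i, j, h.symm⟩

variable {m : ℕ}

/-- Colorings of the theta graph for the full cover given by a permutation on each edge. -/
abbrev ThetaColoring (τ : ∀ i : Fin n, Fin (l i - 1 + 1) → Equiv.Perm (Fin m)) : Type :=
  {c : ThetaV l → Fin m // ∀ i j, c (thetaTgt l i j) ≠ τ i j (c (thetaSrc l i j))}

lemma comp_thetaSrc (c : ThetaV l → Fin m) (i : Fin n) (j : Fin (l i - 1 + 1)) :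
    c (thetaSrc l i j) = (Fin.cons (c (thetaU l)) fun j => c (Sum.inr ⟨i, j⟩) :
      Fin (l i - 1 + 1) → Fin m) j := by
  cases j using Fin.cases <;> rfl

lemma comp_thetaTgt (c : ThetaV l → Fin m) (i : Fin n) (j : Fin (l i - 1 + 1)) :
    c (thetaTgt l i j) = (Fin.snoc (fun j => c (Sum.inr ⟨i, j⟩)) (c (thetaW l)) :
      Fin (l i - 1 + 1) → Fin m) j := by
  cases j using Fin.lastCases <;> simp [thetaTgt]

/-- A coloring of a theta graph consists of the colors of the two ends and colorings of the
paths between them. -/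
def thetaColoringEquiv (τ : ∀ i : Fin n, Fin (l i - 1 + 1) → Equiv.Perm (Fin m)) :
    ThetaColoring τ ≃ Σ p : Fin m × Fin m, ∀ i, PathColoring (τ i) p.1 p.2 where
  toFun c := ⟨(c.1 (thetaU l), c.1 (thetaW l)), fun i => ⟨fun j => c.1 (Sum.inr ⟨i, j⟩),
    fun j => by simpa only [comp_thetaSrc, comp_thetaTgt] using c.2 i j⟩⟩
  invFun s := ⟨Sum.elim (fun b => cond b s.1.2 s.1.1) fun q => (s.2 q.1).1 q.2, fun i j => by
    rw [comp_thetaSrc (Sum.elim _ _), comp_thetaTgt (Sum.elim _ _)]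
    exact (s.2 i).2 j⟩
  left_inv c := by
    apply Subtype.ext
    funext x
    rcases x with (_ | _) | ⟨i, j⟩ <;> rfl
  right_inv s := rfl

lemma card_thetaColoring (τ : ∀ i : Fin n, Fin (l i - 1 + 1) → Equiv.Perm (Fin m)) :
    Nat.card (ThetaColoring τ) =
      ∑ a, ∑ b, ∏ i, Nat.card (PathColoring (τ i) a b) := by
  rw [Nat.card_congr (thetaColoringEquiv τ), Nat.card_sigma, Fintype.sum_prod_type]
  simp only [Nat.card_pi]

lemma exists_card_thetaColoring_le_count (hl : ∀ i, 1 ≤ l i) (C : DPCover (thetaGraph l) m) :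
    ∃ τ : ∀ i : Fin n, Fin (l i - 1 + 1) → Equiv.Perm (Fin m),
      Nat.card (ThetaColoring τ) ≤ C.count := by
  have key (i : Fin n) (j : Fin (l i - 1 + 1)) : ∃ σ : Equiv.Perm (Fin m), ∀ a b,
      C.H.Adj (thetaSrc l i j, a) (thetaTgt l i j, b) → b = σ a := by
    have hne := (thetaGraph_adj_src_tgt hl i j).ne
    exact exists_perm_of_matching _ (fun a b b' => C.cross_matching _ _ hne a b b')
      fun a a' b h h' => C.cross_matching _ _ hne.symm b a a' h.symm h'.symm
  choose τ hτ using key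
  refine ⟨τ, Nat.card_le_card_of_injective
    (fun c => ⟨c.1, fun u v huv h => ?_⟩) fun _ _ h => Subtype.ext (Subtype.mk.inj h)⟩
  obtain ⟨i, j, ⟨rfl, rfl⟩ | ⟨rfl, rfl⟩⟩ :=
    exists_src_tgt_of_adj (C.cross_only_edges _ _ _ _ huv h)
  · exact c.2 i j (hτ i j _ _ h)
  · exact c.2 i j (hτ i j _ _ h.symm)

end Theta

/-- The full cover in which the edge from `u` to `v` carries the permutation `τ u v`. -/
def permCover {V : Type*} (G : SimpleGraph V) {m : ℕ} (τ : V → V → Equiv.Perm (Fin m))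
    (hτ : ∀ u v, τ v u = (τ u v)⁻¹) : DPCover G m where
  H :=
    { Adj := fun x y => (x.1 = y.1 ∧ x.2 ≠ y.2) ∨ (G.Adj x.1 y.1 ∧ y.2 = τ x.1 y.1 x.2)
      symm := ⟨fun x y h => by
        rcases h with h | ⟨h, h'⟩
        · exact Or.inl ⟨h.1.symm, h.2.symm⟩
        · exact Or.inr ⟨h.symm, by simp [hτ x.1 y.1, h']⟩⟩
      loopless := ⟨fun x h => by
        rcases h with h | h
        · exact h.2 rfl
        · exact h.1.ne rfl⟩ }
  fiber_clique _ _ _ h := Or.inl ⟨rfl, h⟩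
  cross_only_edges u v a b huv h := by
    rcases h with h | h
    · exact absurd h.1 huv
    · exact h.1
  cross_matching u v huv a b b' h h' := by
    rcases h with h | h
    · exact absurd h.1 huv
    rcases h' with h' | h'
    · exact absurd h'.1 huv
    exact h.2.trans h'.2.symm

lemma permCover_count_le {n m : ℕ} {l : Fin n → ℕ} (hl : ∀ i, 1 ≤ l i)
    (τ : ThetaV l → ThetaV l → Equiv.Perm (Fin m)) (hτ : ∀ u v, τ v u = (τ u v)⁻¹) :
    (permCover (thetaGraph l) τ hτ).count ≤
      Nat.card (ThetaColoring fun i j => τ (thetaSrc l i j) (thetaTgt l i j)) :=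
  Nat.card_le_card_of_injective
    (fun c => ⟨c.1, fun i j h => c.2 _ _ (thetaGraph_adj_src_tgt hl i j).ne
      (Or.inr ⟨thetaGraph_adj_src_tgt hl i j, h⟩)⟩)
    fun _ _ h => Subtype.ext (Subtype.mk.inj h)

/-- A permutation can be placed on the first edge of one path of a theta graph, with the identity
on all the other edges. -/
lemma exists_twist {n m : ℕ} {l : Fin n → ℕ} (k : Fin n) (hk : 2 ≤ l k)
    (ρ : Equiv.Perm (Fin m)) :
    ∃ τ : ThetaV l → ThetaV l → Equiv.Perm (Fin m), (∀ u v, τ v u = (τ u v)⁻¹) ∧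
      ∀ i, pathPerm (fun j => τ (thetaSrc l i j) (thetaTgt l i j)) = if i = k then ρ else 1 := by
  classical
  let q : ThetaV l := Sum.inr ⟨k, ⟨0, by omega⟩⟩
  have hq : q ≠ thetaU l := by simp [q, thetaU]
  refine ⟨fun x y => if x = thetaU l ∧ y = q then ρ else if x = q ∧ y = thetaU l then ρ⁻¹ else 1,
    fun u v => ?_, fun i => ?_⟩
  · by_cases h1 : u = thetaU l ∧ v = q
    · obtain ⟨rfl, rfl⟩ := h1
      simp [hq]
    · by_cases h2 : u = q ∧ v = thetaU l
      · obtain ⟨rfl, rfl⟩ := h2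
        simp [hq]
      · beta_reduce
        rw [if_neg (by tauto), if_neg (by tauto), if_neg h1, if_neg h2, inv_one]
  · have htgt (j : Fin (l i - 1 + 1)) : thetaTgt l i j ≠ thetaU l := by
      cases j using Fin.lastCases with
      | last => simp [thetaTgt_last, thetaU, thetaW]
      | cast j => simp [thetaTgt_castSucc, thetaU]
    rw [pathPerm_eq_zero]
    · beta_reduce
      rw [if_neg (c := thetaSrc l i 0 = q ∧ _) fun h => htgt _ h.2, thetaSrc_zero]
      refine if_congr ?_ rfl rfl
      simp only [true_and]
      constructor
      · intro h
        cases h0 : (0 : Fin (l i - 1 + 1)) using Fin.lastCases with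
        | last => rw [h0, thetaTgt_last] at h; simp [q, thetaW] at h
        | cast j =>
          rw [h0, thetaTgt_castSucc] at h
          exact congrArg Sigma.fst (Sum.inr_injective h)
      · rintro rfl
        have h0 : (0 : Fin (l i - 1 + 1)) = (⟨0, by omega⟩ : Fin (l i - 1)).castSucc := rfl
        rw [h0, thetaTgt_castSucc]
    · intro j
      beta_reduce
      rw [if_neg (by simp [thetaSrc_succ, thetaU]), if_neg fun h => htgt _ h.2]

lemma sum_prod_indicator {α : Type*} [Fintype α] [DecidableEq α] (c₀ c₁ c₂ s : ℚ)
    (hs : s ^ 2 = 1) (x y z : α) :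
    ∑ b, (c₀ + s * if x = b then 1 else 0) * (c₁ - s * if y = b then 1 else 0) *
        (c₂ + s * if z = b then 1 else 0) =
      Fintype.card α * (c₀ * c₁ * c₂) + s * (c₁ * c₂ - c₀ * c₂ + c₀ * c₁)
        - c₂ * (if x = y then 1 else 0) + c₁ * (if x = z then 1 else 0)
        - c₀ * (if y = z then 1 else 0) - s * (if x = y ∧ x = z then 1 else 0) := by
  have key (b : α) : (c₀ + s * if x = b then 1 else 0) * (c₁ - s * if y = b then 1 else 0) *
        (c₂ + s * if z = b then 1 else 0) = c₀ * c₁ * c₂ +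
      (s * (c₁ * c₂) - c₂ * (if x = y then 1 else 0) + c₁ * (if x = z then 1 else 0)
        - s * (if x = y ∧ x = z then 1 else 0)) * (if x = b then 1 else 0)
      - (s * (c₀ * c₂) + c₀ * (if y = z then 1 else 0)) * (if y = b then 1 else 0)
      + s * (c₀ * c₁) * (if z = b then 1 else 0) := by
    by_cases hx : x = b
    · subst hx
      by_cases hy : x = y <;> by_cases hz : x = z <;> simp_all [eq_comm] <;> grind
    · by_cases hy : y = b
      · subst hy
        by_cases hz : y = z <;> simp_all [eq_comm] <;> grind
      · by_cases hz : z = b <;> grind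
  simp_rw [key]
  rw [sum_add_distrib, sum_sub_distrib, sum_add_distrib]
  simp only [← mul_sum, sum_ite_eq, mem_univ, if_true, sum_const, card_univ, nsmul_eq_mul]
  ring


lemma card_thetaColoring_three {m : ℕ} (hm : m ≠ 0) {l : Fin 3 → ℕ} (hl : ∀ i, 1 ≤ l i) {s : ℚ}
    (hs : s ^ 2 = 1) (h0 : (-1) ^ l 0 = s) (h1 : (-1) ^ l 1 = -s) (h2 : (-1) ^ l 2 = s)
    (τ : ∀ i : Fin 3, Fin (l i - 1 + 1) → Equiv.Perm (Fin m)) :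
    (Nat.card (ThetaColoring τ) : ℚ) = ∑ a,
      (m * (walkCount m (l 0) * walkCount m (l 1) * walkCount m (l 2)) +
        s * (walkCount m (l 1) * walkCount m (l 2) - walkCount m (l 0) * walkCount m (l 2) +
          walkCount m (l 0) * walkCount m (l 1))
        - walkCount m (l 2) * (if pathPerm (τ 0) a = pathPerm (τ 1) a then 1 else 0)
        + walkCount m (l 1) * (if pathPerm (τ 0) a = pathPerm (τ 2) a then 1 else 0)
        - walkCount m (l 0) * (if pathPerm (τ 1) a = pathPerm (τ 2) a then 1 else 0)
        - s * (if pathPerm (τ 0) a = pathPerm (τ 1) a ∧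
            pathPerm (τ 0) a = pathPerm (τ 2) a then 1 else 0)) := by
  rw [card_thetaColoring]
  push_cast
  refine sum_congr rfl fun a _ => ?_
  have := sum_prod_indicator (walkCount m (l 0)) (walkCount m (l 1)) (walkCount m (l 2)) s hs
    (pathPerm (τ 0) a) (pathPerm (τ 1) a) (pathPerm (τ 2) a)
  rw [Fintype.card_fin] at this
  rw [← this]
  refine sum_congr rfl fun b _ => ?_
  simp only [Fin.prod_univ_three, card_pathColoring hm, Nat.sub_add_cancel (hl _), h0, h1, h2]
  ring

lemma walkCount_nonneg {m : ℕ} (hm : 2 ≤ m) (n : ℕ) : 0 ≤ walkCount m n := by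
  have hm' : (2 : ℚ) ≤ m := by exact_mod_cast hm
  have h1 : 1 ≤ ((m : ℚ) - 1) ^ n := one_le_pow₀ (by linarith)
  have h2 : (-1 : ℚ) ^ n ≤ 1 := by rcases neg_one_pow_eq_or ℚ n with h | h <;> rw [h]; norm_num
  exact div_nonneg (by linarith) (by linarith)

lemma walkCount_le_of_le {m : ℕ} (hm : 2 ≤ m) {k n : ℕ} (hkn : k ≤ n)
    (h : (-1 : ℚ) ^ k = (-1) ^ n) : walkCount m k ≤ walkCount m n := by
  have hm' : (2 : ℚ) ≤ m := by exact_mod_cast hm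
  have h1 : ((m : ℚ) - 1) ^ k ≤ ((m : ℚ) - 1) ^ n := pow_le_pow_right₀ (by linarith) hkn
  rw [walkCount, walkCount, h]
  gcongr

lemma walkCount_add_le_of_lt {m : ℕ} (hm : 2 ≤ m) {k n : ℕ} (hkn : k < n)
    (h : (-1 : ℚ) ^ n = -(-1) ^ k) : walkCount m k + (-1) ^ k ≤ walkCount m n := by
  have hm' : (2 : ℚ) ≤ m := by exact_mod_cast hm
  have h1 : ((m : ℚ) - 1) ^ (k + 1) ≤ ((m : ℚ) - 1) ^ n := pow_le_pow_right₀ (by linarith) hkn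
  have h2 : 1 ≤ ((m : ℚ) - 1) ^ k := one_le_pow₀ (by linarith)
  have h3 : (-1 : ℚ) ^ k ≤ 1 := by rcases neg_one_pow_eq_or ℚ k with h | h <;> rw [h]; norm_num
  rw [walkCount, walkCount, h, div_add' _ _ _ (by linarith)]
  gcongr ?_ / _
  rw [pow_succ] at h1
  nlinarith [mul_nonneg (show (0 : ℚ) ≤ m - 2 by linarith) (sub_nonneg.2 (h3.trans h2))]

/-- Let `G = Θ(l_1,l_2,l_3)` with `l_1 = min l_i ≥ 1` and `l_2, l_3 ≥ 2`.
If the parity of `l_1` is the same as that of `l_3` and different from that of `l_2`, then for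
all `m ≥ 2`:
`P_DP(G,m) = (1/m)·[(m−1)^{l_1+l_2+l_3} + (m−1)^{l_1} − (m−1)^{l_2} − (m−1)^{l_3+1}
  + (−1)^{l_2+1}(m−2)]`. -/
theorem statement6 (l : Fin 3 → ℕ)
    (hmin : ∀ i : Fin 3, l 0 ≤ l i) (hl1 : 1 ≤ l 0) (hl2 : 2 ≤ l 1) (hl3 : 2 ≤ l 2)
    (hpar3 : l 0 % 2 = l 2 % 2) (hpar2 : l 0 % 2 ≠ l 1 % 2) :
    ∀ m : ℕ, 2 ≤ m →
      (PDP (thetaGraph l) m : ℚ) =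
        (1 / (m : ℚ)) *
          (((m : ℚ) - 1) ^ (l 0 + l 1 + l 2) + ((m : ℚ) - 1) ^ (l 0) - ((m : ℚ) - 1) ^ (l 1) -
            ((m : ℚ) - 1) ^ (l 2 + 1) + (-1 : ℚ) ^ (l 1 + 1) * ((m : ℚ) - 2)) := by
  intro m hm
  have hl : ∀ i, 1 ≤ l i := fun i => hl1.trans (hmin i)
  have hm0 : m ≠ 0 := by omega
  have hmq : (m : ℚ) ≠ 0 := by exact_mod_cast hm0
  obtain ⟨s, h0⟩ : ∃ s : ℚ, (-1) ^ l 0 = s := ⟨_, rfl⟩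
  have hs : s ^ 2 = 1 := by rw [← h0, ← pow_mul, mul_comm, pow_mul]; norm_num
  have h2 : (-1) ^ l 2 = s := by
    rw [← h0, neg_one_pow_eq_pow_mod_two, ← hpar3, ← neg_one_pow_eq_pow_mod_two]
  have h1 : (-1) ^ l 1 = -s := by
    have : (l 1) % 2 = (l 0 + 1) % 2 := by omega
    rw [← h0, neg_one_pow_eq_pow_mod_two, this, ← neg_one_pow_eq_pow_mod_two, pow_succ]
    ring
  have hlt : l 0 < l 1 := lt_of_le_of_ne (hmin 1) fun h => hpar2 (by rw [h])
  have hw02 := walkCount_le_of_le hm (hmin 2) (h0.trans h2.symm)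
  have hw01 := walkCount_add_le_of_lt hm hlt (by rw [h0, h1])
  rw [h0] at hw01
  have hw1 := walkCount_nonneg hm (l 1)
  have hw2 := walkCount_nonneg hm (l 2)
  have hcard := card_thetaColoring_three hm0 hl hs h0 h1 h2
  have hval : (1 / (m : ℚ)) *
      (((m : ℚ) - 1) ^ (l 0 + l 1 + l 2) + ((m : ℚ) - 1) ^ (l 0) - ((m : ℚ) - 1) ^ (l 1) -
        ((m : ℚ) - 1) ^ (l 2 + 1) + (-1 : ℚ) ^ (l 1 + 1) * ((m : ℚ) - 2)) =
      ∑ _a : Fin m, (m * (walkCount m (l 0) * walkCount m (l 1) * walkCount m (l 2)) +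
        s * (walkCount m (l 1) * walkCount m (l 2) - walkCount m (l 0) * walkCount m (l 2) +
          walkCount m (l 0) * walkCount m (l 1)) - walkCount m (l 2)) := by
    simp only [sum_const, card_univ, Fintype.card_fin, nsmul_eq_mul, walkCount, h0, h1, h2,
      pow_add, pow_one]
    generalize ((m : ℚ) - 1) ^ l 0 = x
    generalize ((m : ℚ) - 1) ^ l 1 = y
    generalize ((m : ℚ) - 1) ^ l 2 = z
    field_simp
    grind
  rw [hval]
  apply le_antisymm
  · obtain ⟨k, rfl⟩ : ∃ k, m = k + 2 := ⟨m - 2, by omega⟩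
    obtain ⟨τ, hτ, hperm⟩ := exists_twist (m := k + 2) 2 hl3 (finRotate (k + 2))
    have hmem : (permCover (thetaGraph l) τ hτ).count ∈
        Set.range fun C : DPCover (thetaGraph l) (k + 2) => C.count := ⟨_, rfl⟩
    have hle := (Nat.sInf_le hmem).trans (permCover_count_le hl τ hτ)
    refine (Nat.cast_le.2 hle).trans (le_of_eq ?_)
    rw [hcard]
    refine sum_congr rfl fun a _ => ?_
    have ha : a ≠ a + 1 := by simp
    simp [hperm, ha]
  · have : Nonempty (DPCover (thetaGraph l) m) :=
      ⟨permCover _ (fun _ _ => 1) fun _ _ => inv_one.symm⟩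
    obtain ⟨C, hC⟩ : PDP (thetaGraph l) m ∈ Set.range fun C : DPCover (thetaGraph l) m => C.count :=
      Nat.sInf_mem (Set.range_nonempty _)
    obtain ⟨τ, hτ⟩ := exists_card_thetaColoring_le_count hl C
    rw [← hC]
    refine le_trans ?_ (Nat.cast_le.2 hτ)
    rw [hcard]
    refine sum_le_sum fun a _ => ?_
    split_ifs <;> first | linarith | (exfalso; grind)
end
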